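/- arXiv:1512.08679 — 2 statements merged into one kernel-verified Lean document; each statement's English description precedes it below -/
import Mathlib

section
/- If P > 1/2 and 0 ≤ α₁ < α₂ ≤ 1, then the game Γ₁ has a unique Nash equilibrium, namely (BW, FW). -/
/-- `C x = (1/2) * log (1 + x)` (natural logarithm). -/
noncomputable def C (x : ℝ) : ℝ := (1/2) * Real.log (1 + x)

/-- `Λ₁(α₁,α₂)` for power `P`. -/
noncomputable def Lam1 (P a1 a2 : ℝ) : ℝ :=
  P ^ 2 * (a1 + a2) ^ 2 /
    (1 + (2 + a1 ^ 2 + a2 ^ 2) * P + (1 - a1 * a2) ^ 2 * P ^ 2)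

/-- Pure strategies of the game Γ₁. -/
inductive Strat where
  | FW : Strat
  | BW : Strat

/-- Payoff (secret key rate) of player 1 in the game Γ₁. -/
noncomputable def R1 (P a1 a2 : ℝ) : Strat → Strat → ℝ
  | Strat.FW, Strat.FW => C (P / (1 + a1 ^ 2 * P)) - C (a2 ^ 2 * P)
  | Strat.FW, Strat.BW => C (P / (1 + a1 ^ 2 * P)) - C (a2 ^ 2 * P / (1 + P))
  | Strat.BW, Strat.FW => C (P / (1 + a1 ^ 2 * P)) -
      C ((a1 ^ 2 * P + a2 ^ 2 * P ^ 2 + a1 ^ 2 * a2 ^ 2 * P ^ 2) / (1 + P + a2 ^ 2 * P))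
  | Strat.BW, Strat.BW => C (P / (1 + a1 ^ 2 * P)) - C (Lam1 P a1 a2)

/-- Payoff (secret key rate) of player 2 in the game Γ₁. -/
noncomputable def R2 (P a1 a2 : ℝ) : Strat → Strat → ℝ
  | Strat.FW, Strat.FW => C (P / (1 + a2 ^ 2 * P)) - C (a1 ^ 2 * P)
  | Strat.BW, Strat.FW => C (P / (1 + a2 ^ 2 * P)) - C (a1 ^ 2 * P / (1 + P))
  | Strat.FW, Strat.BW => C (P / (1 + a2 ^ 2 * P)) -
      C ((a2 ^ 2 * P + a1 ^ 2 * P ^ 2 + a1 ^ 2 * a2 ^ 2 * P ^ 2) / (1 + P + a1 ^ 2 * P))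
  | Strat.BW, Strat.BW => C (P / (1 + a2 ^ 2 * P)) - C (Lam1 P a1 a2)

/-- `(s1, s2)` is a Nash equilibrium of the game Γ₁. -/
def IsNE (P a1 a2 : ℝ) (s1 s2 : Strat) : Prop :=
  (∀ t1 : Strat, R1 P a1 a2 s1 s2 ≥ R1 P a1 a2 t1 s2) ∧
  (∀ t2 : Strat, R2 P a1 a2 s1 s2 ≥ R2 P a1 a2 s1 t2)

theorem C_lt_C {x y : ℝ} (hx : -1 < x) (hxy : x < y) : C x < C y := by
  unfold C
  have := Real.log_lt_log (by linarith : 0 < 1 + x) (by linarith : 1 + x < 1 + y)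
  linarith

/-- Player 1, having the smaller gain, strictly prefers BW against FW. -/
theorem loss_BW_FW_lt {P x y : ℝ} (hP : 0 < P) (hx : 0 ≤ x) (hxy : x < y) :
    (x * P + y * P ^ 2 + x * y * P ^ 2) / (1 + P + y * P) < y * P := by
  have hy : 0 < y := hx.trans_lt hxy
  rw [div_lt_iff₀ (by positivity)]
  have : 0 < P * ((y - x) * (1 + y * P)) :=
    mul_pos hP (mul_pos (sub_pos.2 hxy) (by positivity))
  linarith

/-- Player 2, having the larger gain, strictly prefers FW against FW. -/
theorem lt_loss_FW_BW {P x y : ℝ} (hP : 0 < P) (hx : 0 ≤ x) (hxy : x < y) :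
    x * P < (y * P + x * P ^ 2 + x * y * P ^ 2) / (1 + P + x * P) := by
  rw [lt_div_iff₀ (by positivity)]
  have : 0 < P * ((y - x) * (1 + x * P)) :=
    mul_pos hP (mul_pos (sub_pos.2 hxy) (by positivity))
  linarith

/-- Player 2 strictly prefers FW against BW. -/
theorem lt_Lam1 {P a b : ℝ} (hP : 1 / 2 < P) (ha : 0 ≤ a) (hab : a < b) (hb : b ≤ 1) :
    a ^ 2 * P / (1 + P) < Lam1 P a b := by
  have hP0 : 0 < P := by linarith
  have hb0 : 0 < b := ha.trans_lt hab
  unfold Lam1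
  rw [div_lt_div_iff₀ (by positivity) (by positivity)]
  suffices h : a ^ 2 * (1 + (2 + a ^ 2 + b ^ 2) * P + (1 - a * b) ^ 2 * P ^ 2)
      < P * (1 + P) * (a + b) ^ 2 by
    linarith [mul_lt_mul_of_pos_left h hP0]
  have hsum : 4 * a ^ 2 < (a + b) ^ 2 := by nlinarith
  have hu0 : 0 ≤ 1 - a ^ 2 := by nlinarith
  have hb2 : b ^ 2 ≤ 1 := by nlinarith
  have hprod : (1 - a * b) ^ 2 ≤ 1 - a ^ 2 := by
    have h₁ : 0 ≤ 1 - a * b := by nlinarith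
    have h₂ : 1 - a * b ≤ 1 - a ^ 2 := by nlinarith
    nlinarith
  have hfac : 1 + (2 + a ^ 2 + b ^ 2) * P + (1 - a * b) ^ 2 * P ^ 2 ≤ 4 * (P * (1 + P)) := by
    have h₁ := mul_le_mul_of_nonneg_right hprod (sq_nonneg P)
    have h₂ := mul_le_mul_of_nonneg_right hb2 hP0.le
    have h₃ : 0 ≤ a ^ 2 * (4 * P ^ 2 - 1) := mul_nonneg (sq_nonneg a) (by nlinarith)
    have h₄ : 0 ≤ (1 - a ^ 2) * (3 * P ^ 2 + P - 1) := mul_nonneg hu0 (by nlinarith)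
    linarith
  calc _ ≤ a ^ 2 * (4 * (P * (1 + P))) := mul_le_mul_of_nonneg_left hfac (sq_nonneg a)
    _ = P * (1 + P) * (4 * a ^ 2) := by ring
    _ < _ := mul_lt_mul_of_pos_left hsum (by positivity)

/-- If `P > 1/2` and `0 ≤ α₁ < α₂ ≤ 1`, then the game Γ₁ has a unique Nash
equilibrium, namely `(BW, FW)`. -/
theorem stmt3 (P a1 a2 : ℝ) (hP : 1/2 < P)
    (h1 : 0 ≤ a1) (h12 : a1 < a2) (h2 : a2 ≤ 1) :
    ∀ s1 s2 : Strat, IsNE P a1 a2 s1 s2 ↔ (s1 = Strat.BW ∧ s2 = Strat.FW) := by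
  have hP0 : 0 < P := by linarith
  have hx : 0 ≤ a1 ^ 2 := sq_nonneg a1
  have hxy : a1 ^ 2 < a2 ^ 2 := by nlinarith
  have hBF : R1 P a1 a2 Strat.FW Strat.FW < R1 P a1 a2 Strat.BW Strat.FW :=
    sub_lt_sub_left (C_lt_C (neg_one_lt_zero.trans_le (by positivity))
      (loss_BW_FW_lt hP0 hx hxy)) _
  have hFB : R2 P a1 a2 Strat.FW Strat.BW < R2 P a1 a2 Strat.FW Strat.FW :=
    sub_lt_sub_left (C_lt_C (neg_one_lt_zero.trans_le (by positivity))
      (lt_loss_FW_BW hP0 hx hxy)) _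
  have hBB : R2 P a1 a2 Strat.BW Strat.BW < R2 P a1 a2 Strat.BW Strat.FW :=
    sub_lt_sub_left (C_lt_C (neg_one_lt_zero.trans_le (by positivity))
      (lt_Lam1 hP h1 h12 h2)) _
  intro s1 s2
  constructor
  · rintro ⟨hs1, hs2⟩
    cases s1 <;> cases s2
    · exact absurd hBF (hs1 Strat.BW).not_gt
    · exact absurd hFB (hs2 Strat.FW).not_gt
    · exact ⟨rfl, rfl⟩
    · exact absurd hBB (hs2 Strat.FW).not_gt
  · rintro ⟨rfl, rfl⟩
    constructor
    · rintro (_ | _)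
      exacts [hBF.le, le_rfl]
    · rintro (_ | _)
      exacts [le_rfl, hBB.le]
end

section
/- For P > 0 and α₁, α₂ ∈ [0,1], the strategy pair (FW, BW) is a Nash equilibrium of the game Γ₁ if and only if α₂²·P/(1+P) ≤ Λ₁(α₁,α₂) and α₂ ≤ α₁. -/
theorem C_le_C_iff {x y : ℝ} (hx : 0 ≤ x) (hy : 0 ≤ y) : C x ≤ C y ↔ x ≤ y := by
  unfold C
  rw [mul_le_mul_iff_right₀ (by norm_num : (0 : ℝ) < 1 / 2),
    Real.log_le_log_iff (by linarith) (by linarith), add_le_add_iff_left]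

theorem Lam1_nonneg {P : ℝ} (hP : 0 ≤ P) (a1 a2 : ℝ) : 0 ≤ Lam1 P a1 a2 := by
  unfold Lam1
  positivity

/-- The leakage term of player 2 at `(FW, BW)` is at most the one at `(FW, FW)` exactly when
`a2 ≤ a1`. -/
theorem leakage_le_iff {P a1 a2 : ℝ} (hP : 0 < P) (h1 : 0 ≤ a1) (h2 : 0 ≤ a2) :
    (a2 ^ 2 * P + a1 ^ 2 * P ^ 2 + a1 ^ 2 * a2 ^ 2 * P ^ 2) / (1 + P + a1 ^ 2 * P) ≤ a1 ^ 2 * P ↔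
      a2 ≤ a1 := by
  have hfac : a1 ^ 2 * P * (1 + P + a1 ^ 2 * P) -
      (a2 ^ 2 * P + a1 ^ 2 * P ^ 2 + a1 ^ 2 * a2 ^ 2 * P ^ 2) =
      P * (1 + a1 ^ 2 * P) * (a1 ^ 2 - a2 ^ 2) := by ring
  have hpos : 0 < P * (1 + a1 ^ 2 * P) := by positivity
  rw [div_le_iff₀ (by positivity), ← sub_nonneg, hfac, mul_nonneg_iff_of_pos_left hpos,
    sub_nonneg, sq_le_sq₀ h2 h1]

/-- For `P > 0` and `α₁, α₂ ∈ [0,1]`, the strategy pair `(FW, BW)` is a Nash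
equilibrium of Γ₁ iff `α₂²·P/(1+P) ≤ Λ₁(α₁,α₂)` and `α₂ ≤ α₁`. -/
theorem stmt11 (P a1 a2 : ℝ) (hP : 0 < P)
    (h1 : a1 ∈ Set.Icc (0 : ℝ) 1) (h2 : a2 ∈ Set.Icc (0 : ℝ) 1) :
    IsNE P a1 a2 Strat.FW Strat.BW ↔
      (a2 ^ 2 * P / (1 + P) ≤ Lam1 P a1 a2 ∧ a2 ≤ a1) := by
  have hR1 : R1 P a1 a2 Strat.BW Strat.BW ≤ R1 P a1 a2 Strat.FW Strat.BW ↔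
      a2 ^ 2 * P / (1 + P) ≤ Lam1 P a1 a2 := by
    simp only [R1, sub_le_sub_iff_left]
    exact C_le_C_iff (by positivity) (Lam1_nonneg hP.le a1 a2)
  have hR2 : R2 P a1 a2 Strat.FW Strat.FW ≤ R2 P a1 a2 Strat.FW Strat.BW ↔ a2 ≤ a1 := by
    simp only [R2, sub_le_sub_iff_left]
    rw [C_le_C_iff (by positivity) (by positivity), leakage_le_iff hP h1.1 h2.1]
  rw [← hR1, ← hR2]
  constructor
  · rintro ⟨h, h'⟩
    exact ⟨h Strat.BW, h' Strat.FW⟩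
  · rintro ⟨h, h'⟩
    exact ⟨fun | .FW => le_rfl | .BW => h, fun | .FW => h' | .BW => le_rfl⟩
end
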